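/- A full post-LayerNorm Transformer layer with transformed parameters is column-permutation equivariant. Fix x ∈ ℝ^{n×d}, weights W_q, W_k, W_v, W_o ∈ ℝ^{d×d}, W₁ ∈ ℝ^{d×m}, W₂ ∈ ℝ^{m×d}, LayerNorm weights γ₁, β₁, γ₂, β₂ ∈ ℝ^d, mask M ∈ ℝ^{n×n}, constant k > 0, and define the layer output f(x) = y via u = SoftMax((xW_q)(xW_k)ᵀ/√k + M)(xW_v)W_o, v = LayerNorm(u + x; γ₁, β₁), z = ReLU(vW₁)W₂, y = LayerNorm(z + v; γ₂, β₂). Given d×d permutation matrices π, π₁, π₂ and an m×m permutation matrix π₃, define transformed parameters W_q' = πᵀW_qπ₁, W_k' = πᵀW_kπ₁, W_v' = πᵀW_vπ₂, W_o' = π₂ᵀW_oπ, W₁' = πᵀW₁π₃, W₂' = π₃ᵀW₂π, γ₁' = γ₁π, β₁' = β₁π, γ₂' = γ₂π, β₂' = β₂π, and let f'(·) be the layer with these transformed parameters. Then f'(xπ) = f(x)π. -/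

import Mathlib

open Matrix

noncomputable section

/-- The `d × d` real permutation matrix of a permutation `σ`, with `π i j = 1` iff `σ i = j`. -/
def permMatrix {d : ℕ} (σ : Equiv.Perm (Fin d)) : Matrix (Fin d) (Fin d) ℝ :=
  Matrix.of fun i j => if σ i = j then (1 : ℝ) else 0

/-- Row-wise SoftMax: `SoftMax(z)_{ij} = exp(z_{ij}) / Σ_k exp(z_{ik})`. -/
def softmax {n m : ℕ} (z : Matrix (Fin n) (Fin m) ℝ) : Matrix (Fin n) (Fin m) ℝ :=
  Matrix.of fun i j => Real.exp (z i j) / ∑ k, Real.exp (z i k)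

/-- Mean of row `i` of `x`: `μ_i = (1/d) Σ_j x_{ij}`. -/
def rowMean {n d : ℕ} (x : Matrix (Fin n) (Fin d) ℝ) (i : Fin n) : ℝ :=
  (∑ j, x i j) / d

/-- Standard deviation of row `i` of `x`: `σ_i = sqrt((1/d) Σ_j (x_{ij} − μ_i)²)`. -/
def rowStd {n d : ℕ} (x : Matrix (Fin n) (Fin d) ℝ) (i : Fin n) : ℝ :=
  Real.sqrt ((∑ j, (x i j - rowMean x i) ^ 2) / d)

/-- LayerNorm with weights `γ, β`:
`LayerNorm(x; γ, β)_{ij} = γ_j · (x_{ij} − μ_i)/σ_i + β_j`. -/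
def layerNorm {n d : ℕ} (x : Matrix (Fin n) (Fin d) ℝ) (γ β : Fin d → ℝ) :
    Matrix (Fin n) (Fin d) ℝ :=
  Matrix.of fun i j => γ j * ((x i j - rowMean x i) / rowStd x i) + β j

/-- ReLU applied entrywise to a matrix: `ReLU(t) = max(t, 0)`. -/
def reluMat {n m : ℕ} (x : Matrix (Fin n) (Fin m) ℝ) : Matrix (Fin n) (Fin m) ℝ :=
  Matrix.of fun i j => max (x i j) 0

/-- A post-LayerNorm Transformer layer:
`u = SoftMax((xW_q)(xW_k)ᵀ/√k + M)(xW_v)W_o`, `v = LayerNorm(u + x; γ₁, β₁)`,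
`z = ReLU(vW₁)W₂`, output `y = LayerNorm(z + v; γ₂, β₂)`. -/
def transformerLayer {n d m : ℕ}
    (Wq Wk Wv Wo : Matrix (Fin d) (Fin d) ℝ)
    (W₁ : Matrix (Fin d) (Fin m) ℝ) (W₂ : Matrix (Fin m) (Fin d) ℝ)
    (γ₁ β₁ γ₂ β₂ : Fin d → ℝ)
    (M : Matrix (Fin n) (Fin n) ℝ) (k : ℝ)
    (x : Matrix (Fin n) (Fin d) ℝ) : Matrix (Fin n) (Fin d) ℝ :=
  let u := softmax ((Real.sqrt k)⁻¹ • ((x * Wq) * (x * Wk)ᵀ) + M) * (x * Wv) * Wo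
  let v := layerNorm (u + x) γ₁ β₁
  let z := reluMat (v * W₁) * W₂
  layerNorm (z + v) γ₂ β₂

theorem mul_permMatrix {n d : ℕ} (x : Matrix (Fin n) (Fin d) ℝ) (σ : Equiv.Perm (Fin d)) :
    x * permMatrix σ = x.submatrix id σ.symm := by
  ext i j
  simp [Matrix.mul_apply, permMatrix, ← Equiv.eq_symm_apply]

theorem vecMul_permMatrix {d : ℕ} (γ : Fin d → ℝ) (σ : Equiv.Perm (Fin d)) :
    γ ᵥ* permMatrix σ = γ ∘ σ.symm := by
  ext j
  simp [Matrix.vecMul, dotProduct, permMatrix, ← Equiv.eq_symm_apply]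

theorem permMatrix_mul_transpose {d : ℕ} (σ : Equiv.Perm (Fin d)) :
    permMatrix σ * (permMatrix σ)ᵀ = 1 := by
  ext i j
  simp [Matrix.mul_apply, permMatrix, Matrix.one_apply, eq_comm]

theorem mul_permMatrix_mul_transpose_mul {n d m l : ℕ} (x : Matrix (Fin n) (Fin d) ℝ)
    (σ : Equiv.Perm (Fin d)) (W : Matrix (Fin d) (Fin m) ℝ) (A : Matrix (Fin m) (Fin l) ℝ) :
    x * permMatrix σ * ((permMatrix σ)ᵀ * W * A) = x * W * A := by
  calc x * permMatrix σ * ((permMatrix σ)ᵀ * W * A)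
      = x * (permMatrix σ * (permMatrix σ)ᵀ) * W * A := by simp only [Matrix.mul_assoc]
    _ = x * W * A := by rw [permMatrix_mul_transpose, Matrix.mul_one]

theorem mul_permMatrix_mul_transpose {n l d : ℕ} (x : Matrix (Fin n) (Fin d) ℝ)
    (y : Matrix (Fin l) (Fin d) ℝ) (σ : Equiv.Perm (Fin d)) :
    x * permMatrix σ * (y * permMatrix σ)ᵀ = x * yᵀ := by
  rw [Matrix.transpose_mul, Matrix.mul_assoc, ← Matrix.mul_assoc (permMatrix σ),
    permMatrix_mul_transpose, Matrix.one_mul]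

theorem reluMat_mul_permMatrix {n d : ℕ} (x : Matrix (Fin n) (Fin d) ℝ)
    (σ : Equiv.Perm (Fin d)) : reluMat (x * permMatrix σ) = reluMat x * permMatrix σ := by
  simp only [mul_permMatrix]
  rfl

theorem rowMean_mul_permMatrix {n d : ℕ} (x : Matrix (Fin n) (Fin d) ℝ)
    (σ : Equiv.Perm (Fin d)) (i : Fin n) : rowMean (x * permMatrix σ) i = rowMean x i := by
  simp only [mul_permMatrix, rowMean, Matrix.submatrix_apply, id]
  rw [Equiv.sum_comp σ.symm (fun j => x i j)]

theorem rowStd_mul_permMatrix {n d : ℕ} (x : Matrix (Fin n) (Fin d) ℝ)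
    (σ : Equiv.Perm (Fin d)) (i : Fin n) : rowStd (x * permMatrix σ) i = rowStd x i := by
  simp only [rowStd, rowMean_mul_permMatrix]
  simp only [mul_permMatrix, Matrix.submatrix_apply, id]
  rw [Equiv.sum_comp σ.symm (fun j => (x i j - rowMean x i) ^ 2)]

theorem layerNorm_mul_permMatrix {n d : ℕ} (x : Matrix (Fin n) (Fin d) ℝ) (γ β : Fin d → ℝ)
    (σ : Equiv.Perm (Fin d)) :
    layerNorm (x * permMatrix σ) (γ ᵥ* permMatrix σ) (β ᵥ* permMatrix σ) =
      layerNorm x γ β * permMatrix σ := by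
  ext i j
  simp only [layerNorm, rowMean_mul_permMatrix, rowStd_mul_permMatrix]
  simp only [mul_permMatrix, vecMul_permMatrix, Matrix.of_apply, Matrix.submatrix_apply, id,
    Function.comp_apply]

/-- A full post-LayerNorm Transformer layer with transformed parameters is
column-permutation equivariant: `f'(xπ) = f(x)π`. -/
theorem transformer_layer_transformed_equivariant {n d m : ℕ}
    (x : Matrix (Fin n) (Fin d) ℝ)
    (Wq Wk Wv Wo : Matrix (Fin d) (Fin d) ℝ)
    (W₁ : Matrix (Fin d) (Fin m) ℝ) (W₂ : Matrix (Fin m) (Fin d) ℝ)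
    (γ₁ β₁ γ₂ β₂ : Fin d → ℝ)
    (M : Matrix (Fin n) (Fin n) ℝ) (k : ℝ) (hk : 0 < k)
    (σ σ₁ σ₂ : Equiv.Perm (Fin d)) (σ₃ : Equiv.Perm (Fin m)) :
    let π := permMatrix σ
    let π₁ := permMatrix σ₁
    let π₂ := permMatrix σ₂
    let π₃ := permMatrix σ₃
    transformerLayer (πᵀ * Wq * π₁) (πᵀ * Wk * π₁) (πᵀ * Wv * π₂) (π₂ᵀ * Wo * π)
        (πᵀ * W₁ * π₃) (π₃ᵀ * W₂ * π)
        (γ₁ ᵥ* π) (β₁ ᵥ* π) (γ₂ ᵥ* π) (β₂ ᵥ* π) M k (x * π) =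
      transformerLayer Wq Wk Wv Wo W₁ W₂ γ₁ β₁ γ₂ β₂ M k x * π := by
  intro π π₁ π₂ π₃
  simp only [transformerLayer, π, π₁, π₂, π₃, mul_permMatrix_mul_transpose_mul,
    mul_permMatrix_mul_transpose]
  have attn (S : Matrix (Fin n) (Fin n) ℝ) :
      S * (x * Wv * permMatrix σ₂) * ((permMatrix σ₂)ᵀ * Wo * permMatrix σ) =
        S * (x * Wv) * Wo * permMatrix σ := by
    rw [← Matrix.mul_assoc S, mul_permMatrix_mul_transpose_mul]
  simp only [attn, ← Matrix.add_mul, layerNorm_mul_permMatrix, mul_permMatrix_mul_transpose_mul,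
    reluMat_mul_permMatrix]
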